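/- Let m ≥ 1, let P_1, …, P_m be nonempty polytopes in ℝ^d (convex hulls of finite sets), and let λ = (λ_1, …, λ_m) ∈ ℝ^m with λ_i > 0 for all i and Σ λ_i = 1. Then the map G ↦ G ∩ (ℝ^d × {λ}) is a bijection from the set of nonempty exposed faces G of Cay(P_1, …, P_m) that are not contained in Cay(P_S) for any proper subset S ⊊ {1, …, m}, onto the set of sets of the form F × {λ} where F is a nonempty exposed face of the weighted Minkowski sum λ_1 P_1 + ⋯ + λ_m P_m. Moreover, under this correspondence dim(affine span of G) = dim(affine span of F) + m − 1. -/

import Mathlib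

open Pointwise

/-- The Cayley polytope `Cay(P 1, …, P m) = conv (⋃ i, P i × {e i}) ⊆ ℝ^d × ℝ^m`. -/
def cayleyPolytope (d m : ℕ) (V : Fin m → Set (Fin d → ℝ)) :
    Set ((Fin d → ℝ) × (Fin m → ℝ)) :=
  convexHull ℝ (⋃ i : Fin m, (convexHull ℝ (V i)) ×ˢ ({Pi.single i 1} : Set (Fin m → ℝ)))

/-- The sub-Cayley polytope `Cay(P_S) = conv (⋃ i ∈ S, P i × {e i})`. -/
def subCayleyPolytope (d m : ℕ) (V : Fin m → Set (Fin d → ℝ)) (S : Finset (Fin m)) :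
    Set ((Fin d → ℝ) × (Fin m → ℝ)) :=
  convexHull ℝ (⋃ i ∈ S, (convexHull ℝ (V i)) ×ˢ ({Pi.single i 1} : Set (Fin m → ℝ)))

section CayleySet

variable {ι E : Type*} [Fintype ι] [AddCommGroup E] [Module ℝ E]

/-- Explicit description of the convex hull of `⋃ i, Q i × {e i}` for convex nonempty `Q i`. -/
def cayleySet (Q : ι → Set E) : Set (E × (ι → ℝ)) :=
  {z | z.2 ∈ stdSimplex ℝ ι ∧ ∃ p : ι → E, (∀ i, p i ∈ Q i) ∧ z.1 = ∑ i, z.2 i • p i}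

theorem convex_cayleySet {Q : ι → Set E} (hQ : ∀ i, Convex ℝ (Q i)) :
    Convex ℝ (cayleySet Q) := by
  rintro ⟨x, μ⟩ ⟨hμ, p, hp, hx⟩ ⟨y, ν⟩ ⟨hν, q, hq, hy⟩ a b ha hb hab
  dsimp only at hμ hν hx hy
  refine ⟨convex_stdSimplex ℝ ι hμ hν ha hb hab, ?_⟩
  have key : ∀ i, ∃ r ∈ Q i, (a * μ i + b * ν i) • r = (a * μ i) • p i + (b * ν i) • q i := by
    intro i
    have h1 : 0 ≤ a * μ i := mul_nonneg ha (hμ.1 i)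
    have h2 : 0 ≤ b * ν i := mul_nonneg hb (hν.1 i)
    rcases (add_nonneg h1 h2).eq_or_lt with h | h
    · refine ⟨p i, hp i, ?_⟩
      have h3 : a * μ i = 0 := by linarith
      have h4 : b * ν i = 0 := by linarith
      simp [h3, h4]
    · refine ⟨(a * μ i / (a * μ i + b * ν i)) • p i + (b * ν i / (a * μ i + b * ν i)) • q i,
        hQ i (hp i) (hq i) (by positivity) (by positivity) (by field_simp), ?_⟩
      rw [smul_add, smul_smul, smul_smul, mul_div_cancel₀ _ h.ne', mul_div_cancel₀ _ h.ne']
  choose r hr hr' using key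
  refine ⟨r, hr, ?_⟩
  simp only [Prod.fst_add, Prod.smul_fst, Prod.snd_add, Prod.smul_snd, Pi.add_apply,
    Pi.smul_apply, smul_eq_mul, hr', Finset.sum_add_distrib, hx, hy, Finset.smul_sum, smul_smul]

theorem mk_single_mem_cayleySet [DecidableEq ι] {Q : ι → Set E} {q : ι → E}
    (hq : ∀ i, q i ∈ Q i) {i : ι} {p : E} (hp : p ∈ Q i) :
    (p, Pi.single i (1 : ℝ)) ∈ cayleySet Q := by
  refine ⟨single_mem_stdSimplex ℝ i, Function.update q i p, fun j => ?_, ?_⟩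
  · rcases eq_or_ne j i with rfl | h
    · simpa using hp
    · simpa [h] using hq j
  · dsimp only
    rw [Finset.sum_eq_single i (fun j _ h => by simp [h]) (by simp)]
    simp

theorem eq_sum_smul_mk_single [DecidableEq ι] {z : E × (ι → ℝ)} {p : ι → E}
    (hz : z.1 = ∑ i, z.2 i • p i) :
    z = ∑ i, z.2 i • (p i, (Pi.single i (1 : ℝ) : ι → ℝ)) := by
  ext j
  · simp [Prod.fst_sum, hz]
  · simp [Prod.snd_sum, Pi.single_apply]

theorem convexHull_iUnion_prod_single [DecidableEq ι] {Q : ι → Set E}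
    (hQ : ∀ i, Convex ℝ (Q i)) (hne : ∀ i, (Q i).Nonempty) :
    convexHull ℝ (⋃ i, Q i ×ˢ ({Pi.single i 1} : Set (ι → ℝ))) = cayleySet Q := by
  choose q hq using hne
  apply Set.Subset.antisymm
  · refine convexHull_min ?_ (convex_cayleySet hQ)
    rintro ⟨x, μ⟩ h
    obtain ⟨i, hx, rfl⟩ := Set.mem_iUnion.1 h
    exact mk_single_mem_cayleySet hq hx
  · rintro z ⟨hμ, p, hp, hz⟩
    rw [eq_sum_smul_mk_single hz]
    exact (convex_convexHull ℝ _).sum_mem (fun i _ => hμ.1 i) hμ.2 fun i _ =>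
      subset_convexHull ℝ _ (Set.mem_iUnion.2 ⟨i, hp i, rfl⟩)

theorem mem_sum_smul_iff {w : ι → ℝ} {Q : ι → Set E} {x : E} :
    x ∈ ∑ i, w i • Q i ↔ ∃ p : ι → E, (∀ i, p i ∈ Q i) ∧ x = ∑ i, w i • p i := by
  rw [Set.mem_fintype_sum]
  constructor
  · rintro ⟨g, hg, rfl⟩
    choose p hp hpg using fun i => Set.mem_smul_set.1 (hg i)
    exact ⟨p, hp, by simp [hpg]⟩
  · rintro ⟨p, hp, rfl⟩
    exact ⟨fun i => w i • p i, fun i => Set.smul_mem_smul_set (hp i), rfl⟩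

/-- The slice of the Cayley set at a point `w` of the simplex is the `w`-weighted Minkowski sum. -/
theorem cayleySet_inter_prod_singleton {w : ι → ℝ} (hw : w ∈ stdSimplex ℝ ι) (Q : ι → Set E) :
    cayleySet Q ∩ (Set.univ ×ˢ ({w} : Set (ι → ℝ))) = (∑ i, w i • Q i) ×ˢ {w} := by
  ext ⟨x, μ⟩
  simp only [Set.mem_inter_iff, Set.mem_prod, Set.mem_univ, true_and, Set.mem_singleton_iff,
    mem_sum_smul_iff]
  constructor
  · rintro ⟨⟨-, h⟩, rfl⟩
    exact ⟨h, rfl⟩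
  · rintro ⟨h, rfl⟩
    exact ⟨⟨hw, h⟩, rfl⟩

theorem sum_smul_update [DecidableEq ι] (w : ι → ℝ) (p : ι → E) (i : ι) (y : E) :
    ∑ j, w j • Function.update p i y j = ∑ j, w j • p j + w i • (y - p i) := by
  rw [← sub_eq_iff_eq_add', ← Finset.sum_sub_distrib,
    Finset.sum_eq_single i (fun j _ h => by simp [h]) (by simp)]
  simp [smul_sub]

section Exposed

variable [TopologicalSpace E] {P : ι → Set E}

theorem sum_smul_mem_toExposed_iff {w : ι → ℝ} (hw : ∀ i, 0 < w i) (f : StrongDual ℝ E)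
    {p : ι → E} (hp : ∀ i, p i ∈ P i) :
    ∑ i, w i • p i ∈ f.toExposed (∑ i, w i • P i) ↔ ∀ i, p i ∈ f.toExposed (P i) := by
  classical
  constructor
  · rintro ⟨-, h⟩ i
    refine ⟨hp i, fun y hy => ?_⟩
    have h' := h (∑ j, w j • Function.update p i y j) (mem_sum_smul_iff.2 ⟨_, fun j => ?_, rfl⟩)
    · rw [sum_smul_update, map_add, map_smul, map_sub, smul_eq_mul] at h'
      nlinarith [hw i]
    · rcases eq_or_ne j i with rfl | hj
      · simpa using hy
      · simpa [hj] using hp j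
  · intro h
    refine ⟨mem_sum_smul_iff.2 ⟨p, hp, rfl⟩, fun y hy => ?_⟩
    obtain ⟨q, hq, rfl⟩ := mem_sum_smul_iff.1 hy
    simp only [map_sum, map_smul, smul_eq_mul]
    exact Finset.sum_le_sum fun i _ => mul_le_mul_of_nonneg_left ((h i).2 _ (hq i)) (hw i).le

theorem toExposed_sum_smul {w : ι → ℝ} (hw : ∀ i, 0 < w i) (f : StrongDual ℝ E) :
    f.toExposed (∑ i, w i • P i) = ∑ i, w i • f.toExposed (P i) := by
  ext x
  constructor
  · intro hx
    obtain ⟨p, hp, rfl⟩ := mem_sum_smul_iff.1 hx.1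
    exact mem_sum_smul_iff.2 ⟨p, (sum_smul_mem_toExposed_iff hw f hp).1 hx, rfl⟩
  · intro hx
    obtain ⟨p, hp, rfl⟩ := mem_sum_smul_iff.1 hx
    exact (sum_smul_mem_toExposed_iff hw f fun i => (hp i).1).2 hp

/-- The weighted Minkowski sum of the faces in direction `f` determines each of these faces. -/
theorem toExposed_le_of_sum_smul_eq {w : ι → ℝ} (hw : ∀ i, 0 < w i) {f g : StrongDual ℝ E}
    (hne : ∀ i, (f.toExposed (P i)).Nonempty)
    (h : ∑ i, w i • f.toExposed (P i) = ∑ i, w i • g.toExposed (P i)) (i : ι) :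
    f.toExposed (P i) ⊆ g.toExposed (P i) := by
  classical
  intro x hx
  choose q hq using hne
  have hp : ∀ j, Function.update q i x j ∈ f.toExposed (P j) := by
    intro j
    rcases eq_or_ne j i with rfl | hj
    · simpa using hx
    · simpa [hj] using hq j
  have hmem : ∑ j, w j • Function.update q i x j ∈ g.toExposed (∑ j, w j • P j) := by
    rw [toExposed_sum_smul hw, ← h]
    exact mem_sum_smul_iff.2 ⟨_, hp, rfl⟩
  simpa using (sum_smul_mem_toExposed_iff hw g fun j => (hp j).1).1 hmem i

theorem apply_eq_sum_mul_mk_single [DecidableEq ι] (l : StrongDual ℝ (E × (ι → ℝ)))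
    {z : E × (ι → ℝ)} {p : ι → E} (hz : z.1 = ∑ i, z.2 i • p i) :
    l z = ∑ i, z.2 i * l (p i, Pi.single i (1 : ℝ)) := by
  conv_lhs => rw [eq_sum_smul_mk_single hz]
  simp only [map_sum, map_smul, smul_eq_mul]

theorem apply_mk_single_eq_of_le [DecidableEq ι] (l : StrongDual ℝ (E × (ι → ℝ))) {M : ℝ}
    (hle : ∀ i, ∀ p ∈ P i, l (p, Pi.single i (1 : ℝ)) ≤ M) {z : E × (ι → ℝ)}
    (hz : z.2 ∈ stdSimplex ℝ ι) {p : ι → E} (hp : ∀ i, p i ∈ P i)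
    (hzp : z.1 = ∑ i, z.2 i • p i) (hM : M ≤ l z) {i : ι} (hi : z.2 i ≠ 0) :
    l (p i, Pi.single i (1 : ℝ)) = M := by
  have hterm : ∀ j ∈ Finset.univ, z.2 j * l (p j, Pi.single j (1 : ℝ)) ≤ z.2 j * M :=
    fun j _ => mul_le_mul_of_nonneg_left (hle j _ (hp j)) (hz.1 j)
  have hsum : ∑ j, z.2 j * M = M := by rw [← Finset.sum_mul, hz.2, one_mul]
  have h : ∑ j, z.2 j * l (p j, Pi.single j (1 : ℝ)) = ∑ j, z.2 j * M :=
    le_antisymm (Finset.sum_le_sum hterm)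
      (by rw [hsum, ← apply_eq_sum_mul_mk_single l hzp]; exact hM)
  exact mul_left_cancel₀ hi ((Finset.sum_eq_sum_iff_of_le hterm).1 h i (Finset.mem_univ i))

/-- If `l` attains the same maximum on every `P i × {e i}`, the face of the Cayley set exposed by
`l` is the Cayley set of the faces of the `P i` exposed by the restriction of `l`. -/
theorem toExposed_cayleySet [DecidableEq ι] (l : StrongDual ℝ (E × (ι → ℝ))) {M : ℝ}
    (hle : ∀ i, ∀ p ∈ P i, l (p, Pi.single i (1 : ℝ)) ≤ M) {q : ι → E} (hq : ∀ i, q i ∈ P i)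
    (hqM : ∀ i, l (q i, Pi.single i (1 : ℝ)) = M) :
    l.toExposed (cayleySet P) =
      cayleySet fun i => (l.comp (ContinuousLinearMap.inl ℝ E (ι → ℝ))).toExposed (P i) := by
  have hsplit : ∀ p i, l (p, Pi.single i (1 : ℝ)) =
      l.comp (ContinuousLinearMap.inl ℝ E (ι → ℝ)) p + l (0, Pi.single i (1 : ℝ)) := by
    intro p i
    simp [← map_add]
  have hface : ∀ i p, p ∈ (l.comp (ContinuousLinearMap.inl ℝ E (ι → ℝ))).toExposed (P i) ↔
      p ∈ P i ∧ l (p, Pi.single i (1 : ℝ)) = M := by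
    refine fun i p => ⟨fun h => ⟨h.1, (hle i p h.1).antisymm ?_⟩, fun h => ⟨h.1, fun y hy => ?_⟩⟩
    · have := h.2 _ (hq i)
      rw [← hqM i, hsplit, hsplit p]
      linarith
    · have := (hle i y hy).trans_eq h.2.symm
      rw [hsplit, hsplit p] at this
      linarith
  ext z
  constructor
  · rintro ⟨⟨hz, p, hp, hzp⟩, hmax⟩
    refine ⟨hz, fun i => if z.2 i = 0 then q i else p i, fun i => ?_, ?_⟩
    · rw [hface]
      dsimp only
      split_ifs with hi
      · exact ⟨hq i, hqM i⟩
      · refine ⟨hp i, apply_mk_single_eq_of_le l hle hz hp hzp ?_ hi⟩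
        exact (hqM i).symm.le.trans (hmax _ (mk_single_mem_cayleySet hq (hq i)))
    · rw [hzp]
      refine Finset.sum_congr rfl fun i _ => ?_
      dsimp only
      split_ifs with hi <;> simp [hi]
  · rintro ⟨hz, p, hp, hzp⟩
    have hp' := fun i => (hface i _).1 (hp i)
    refine ⟨⟨hz, p, fun i => (hp' i).1, hzp⟩, ?_⟩
    rintro y ⟨hy, r, hr, hyr⟩
    rw [apply_eq_sum_mul_mk_single l hzp, apply_eq_sum_mul_mk_single l hyr]
    simp only [(hp' _).2, ← Finset.sum_mul, hz.2, one_mul]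
    calc ∑ i, y.2 i * l (r i, Pi.single i (1 : ℝ)) ≤ ∑ i, y.2 i * M :=
          Finset.sum_le_sum fun i _ => mul_le_mul_of_nonneg_left (hle i _ (hr i)) (hy.1 i)
      _ = M := by rw [← Finset.sum_mul, hy.2, one_mul]

/-- An exposed face of the Cayley set meeting the complement of every facet `z.2 i = 0` is the
Cayley set of the faces of the `P i` exposed by a common functional. -/
theorem IsExposed.exists_eq_cayleySet (hne : ∀ i, (P i).Nonempty) {G : Set (E × (ι → ℝ))}
    (hG : IsExposed ℝ (cayleySet P) G) (hGne : G.Nonempty) (hGi : ∀ i, ∃ z ∈ G, z.2 i ≠ 0) :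
    ∃ f : StrongDual ℝ E, (∀ i, (f.toExposed (P i)).Nonempty) ∧
      G = cayleySet fun i => f.toExposed (P i) := by
  classical
  choose q₀ hq₀ using hne
  obtain ⟨l, rfl⟩ := hG hGne
  obtain ⟨z₀, hz₀, hmax₀⟩ := hGne
  have hle : ∀ i, ∀ p ∈ P i, l (p, Pi.single i (1 : ℝ)) ≤ l z₀ :=
    fun i p hp => hmax₀ _ (mk_single_mem_cayleySet hq₀ hp)
  have hex : ∀ i, ∃ p ∈ P i, l (p, Pi.single i (1 : ℝ)) = l z₀ := by
    intro i
    obtain ⟨z, ⟨⟨hz, p, hp, hzp⟩, hmax⟩, hi⟩ := hGi i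
    exact ⟨p i, hp i, apply_mk_single_eq_of_le l hle hz hp hzp (hmax _ hz₀) hi⟩
  choose q hq hqM using hex
  refine ⟨l.comp (ContinuousLinearMap.inl ℝ E (ι → ℝ)), fun i => ⟨q i, hq i, fun y hy => ?_⟩,
    toExposed_cayleySet l hle hq hqM⟩
  have h := (hle i y hy).trans_eq (hqM i).symm
  have hsub := map_sub l (q i, Pi.single i (1 : ℝ)) (y, Pi.single i (1 : ℝ))
  have hsub' := map_sub l (q i, (0 : ι → ℝ)) (y, (0 : ι → ℝ))
  simp only [Prod.mk_sub_mk, sub_self] at hsub hsub'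
  simp only [ContinuousLinearMap.comp_apply, ContinuousLinearMap.inl_apply]
  linarith

theorem isExposed_cayleySet_toExposed (f : StrongDual ℝ E)
    (hne : ∀ i, (f.toExposed (P i)).Nonempty) :
    IsExposed ℝ (cayleySet P) (cayleySet fun i => f.toExposed (P i)) := by
  classical
  choose q hq using hne
  let c : StrongDual ℝ (ι → ℝ) := ∑ i, f (q i) • ContinuousLinearMap.proj i
  let l : StrongDual ℝ (E × (ι → ℝ)) :=
    f.comp (ContinuousLinearMap.fst ℝ E (ι → ℝ)) - c.comp (ContinuousLinearMap.snd ℝ E (ι → ℝ))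
  have hl : ∀ p i, l (p, Pi.single i (1 : ℝ)) = f p - f (q i) := by
    intro p i
    simp [l, c, Pi.single_apply]
  have hcomp : l.comp (ContinuousLinearMap.inl ℝ E (ι → ℝ)) = f := by
    ext x
    simp [l]
  refine fun _ => ⟨l, ?_⟩
  have h := toExposed_cayleySet (P := P) l (M := 0)
    (fun i p hp => by rw [hl, sub_nonpos]; exact (hq i).2 p hp) (fun i => (hq i).1)
    (fun i => by rw [hl, sub_self])
  rw [hcomp] at h
  exact h.symm

end Exposed

section Dimension

theorem Submodule.finrank_prod_eq_add {F : Type*} [AddCommGroup F] [Module ℝ F]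
    [FiniteDimensional ℝ E] [FiniteDimensional ℝ F] (p : Submodule ℝ E) (q : Submodule ℝ F) :
    Module.finrank ℝ (p.prod q) = Module.finrank ℝ p + Module.finrank ℝ q := by
  rw [← Module.finrank_prod]
  exact LinearEquiv.finrank_eq
    { toFun := fun z => (⟨z.1.1, z.2.1⟩, ⟨z.1.2, z.2.2⟩)
      invFun := fun z => ⟨(z.1.1, z.2.1), z.1.2, z.2.2⟩
      map_add' := fun _ _ => rfl
      map_smul' := fun _ _ => rfl
      left_inv := fun _ => rfl
      right_inv := fun _ => rfl }

/-- The shear `(x, μ) ↦ (x - ∑ i, μ i • q i, μ)`. -/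
def cayleyShear (q : ι → E) : (E × (ι → ℝ)) ≃ₗ[ℝ] (E × (ι → ℝ)) where
  toFun z := (z.1 - Fintype.linearCombination ℝ q z.2, z.2)
  invFun z := (z.1 + Fintype.linearCombination ℝ q z.2, z.2)
  map_add' x y := by
    ext
    · simp only [Prod.fst_add, Prod.snd_add, map_add]
      abel
    · rfl
  map_smul' a x := by
    ext
    · simp [smul_sub]
    · rfl
  left_inv x := by simp
  right_inv x := by simp

theorem cayleyShear_apply (q : ι → E) (z : E × (ι → ℝ)) :
    cayleyShear q z = (z.1 - ∑ i, z.2 i • q i, z.2) := rfl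

/-- The functional `μ ↦ ∑ i, μ i`. -/
def coordSum (ι : Type*) [Fintype ι] : (ι → ℝ) →ₗ[ℝ] ℝ := ∑ i, LinearMap.proj i

theorem coordSum_apply (μ : ι → ℝ) : coordSum ι μ = ∑ i, μ i := by
  simp [coordSum]

theorem finrank_ker_coordSum [Nonempty ι] :
    Module.finrank ℝ (LinearMap.ker (coordSum ι)) + 1 = Fintype.card ι := by
  classical
  have hsurj : LinearMap.range (coordSum ι) = ⊤ := by
    refine LinearMap.range_eq_top.2 fun r => ⟨Pi.single (Classical.arbitrary ι) r, ?_⟩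
    simp [coordSum_apply]
  have h := (coordSum ι).finrank_range_add_finrank_ker
  rw [hsurj, finrank_top, Module.finrank_self, Module.finrank_fintype_fun_eq_card] at h
  omega

theorem map_cayleyShear_vectorSpan [Nonempty ι] {w : ι → ℝ} (hw : w ∈ stdSimplex ℝ ι)
    (hpos : ∀ i, 0 < w i) {Q : ι → Set E} {q : ι → E} (hq : ∀ i, q i ∈ Q i) :
    (vectorSpan ℝ (cayleySet Q)).map (cayleyShear q : (E × (ι → ℝ)) →ₗ[ℝ] (E × (ι → ℝ))) =
      (vectorSpan ℝ (∑ i, w i • Q i)).prod (LinearMap.ker (coordSum ι)) := by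
  classical
  apply le_antisymm
  · have hsub : ∀ i, ∀ p ∈ Q i, p - q i ∈ vectorSpan ℝ (∑ i, w i • Q i) := by
      intro i p hp
      have h : (∑ j, w j • Function.update q i p j) - ∑ j, w j • q j ∈
          vectorSpan ℝ (∑ i, w i • Q i) := by
        refine vsub_mem_vectorSpan ℝ (mem_sum_smul_iff.2 ⟨_, fun j => ?_, rfl⟩)
          (mem_sum_smul_iff.2 ⟨q, hq, rfl⟩)
        rcases eq_or_ne j i with rfl | hj
        · simpa using hp
        · simpa [hj] using hq j
      rw [sum_smul_update, add_sub_cancel_left] at h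
      exact (Submodule.smul_mem_iff _ (hpos i).ne').1 h
    have hmem : ∀ z ∈ cayleySet Q, (cayleyShear q z).1 ∈ vectorSpan ℝ (∑ i, w i • Q i) := by
      rintro z ⟨hz, p, hp, hzp⟩
      rw [cayleyShear_apply, hzp, ← Finset.sum_sub_distrib]
      refine Submodule.sum_mem _ fun i _ => ?_
      rw [← smul_sub]
      exact Submodule.smul_mem _ _ (hsub i _ (hp i))
    rw [vectorSpan_def, Submodule.map_span_le]
    rintro _ ⟨y, hy, z, hz, rfl⟩
    simp only [vsub_eq_sub, LinearEquiv.coe_coe, map_sub]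
    refine ⟨Submodule.sub_mem _ (hmem y hy) (hmem z hz), ?_⟩
    change coordSum ι (y.2 - z.2) = 0
    rw [map_sub, coordSum_apply, coordSum_apply, hy.1.2, hz.1.2, sub_self]
  · have hfst : ∀ x ∈ vectorSpan ℝ (∑ i, w i • Q i), (x, (0 : ι → ℝ)) ∈
        (vectorSpan ℝ (cayleySet Q)).map
          (cayleyShear q : (E × (ι → ℝ)) →ₗ[ℝ] (E × (ι → ℝ))) := by
      suffices h : (vectorSpan ℝ (∑ i, w i • Q i)).map (LinearMap.inl ℝ E (ι → ℝ)) ≤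
          (vectorSpan ℝ (cayleySet Q)).map
            (cayleyShear q : (E × (ι → ℝ)) →ₗ[ℝ] (E × (ι → ℝ))) from
        fun x hx => h ⟨x, hx, rfl⟩
      rw [vectorSpan_def, Submodule.map_span_le]
      rintro _ ⟨x, hx, y, hy, rfl⟩
      refine ⟨(x, w) -ᵥ (y, w), vsub_mem_vectorSpan ℝ ⟨hw, mem_sum_smul_iff.1 hx⟩
        ⟨hw, mem_sum_smul_iff.1 hy⟩, ?_⟩
      simp [cayleyShear_apply]
    have hsnd : ∀ μ ∈ LinearMap.ker (coordSum ι), ((0 : E), μ) ∈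
        (vectorSpan ℝ (cayleySet Q)).map
          (cayleyShear q : (E × (ι → ℝ)) →ₗ[ℝ] (E × (ι → ℝ))) := by
      intro μ hμ
      let i₀ := Classical.arbitrary ι
      have hμ' : ∑ i, μ i = 0 := by rwa [LinearMap.mem_ker, coordSum_apply] at hμ
      refine ⟨∑ i, μ i • ((q i, (Pi.single i (1 : ℝ) : ι → ℝ)) -ᵥ (q i₀, Pi.single i₀ 1)),
        Submodule.sum_mem _ fun i _ => Submodule.smul_mem _ _ <| vsub_mem_vectorSpan ℝ
          (mk_single_mem_cayleySet hq (hq i)) (mk_single_mem_cayleySet hq (hq i₀)), ?_⟩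
      simp only [vsub_eq_sub, smul_sub, Finset.sum_sub_distrib, ← Finset.sum_smul, hμ', zero_smul,
        sub_zero]
      rw [← eq_sum_smul_mk_single (z := (∑ i, μ i • q i, μ)) rfl]
      simp [cayleyShear_apply]
    rintro ⟨x, μ⟩ ⟨hx, hμ⟩
    simpa using Submodule.add_mem _ (hfst x hx) (hsnd μ hμ)

theorem finrank_vectorSpan_cayleySet [FiniteDimensional ℝ E] [Nonempty ι] {w : ι → ℝ}
    (hw : w ∈ stdSimplex ℝ ι) (hpos : ∀ i, 0 < w i) {Q : ι → Set E}
    (hne : ∀ i, (Q i).Nonempty) :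
    Module.finrank ℝ (vectorSpan ℝ (cayleySet Q)) =
      Module.finrank ℝ (vectorSpan ℝ (∑ i, w i • Q i)) + Fintype.card ι - 1 := by
  choose q hq using hne
  rw [← LinearEquiv.finrank_map_eq (cayleyShear q), map_cayleyShear_vectorSpan hw hpos hq,
    Submodule.finrank_prod_eq_add, ← finrank_ker_coordSum (ι := ι)]
  omega

end Dimension

end CayleySet

theorem snd_eq_zero_of_mem_subCayleyPolytope {d m : ℕ} {V : Fin m → Set (Fin d → ℝ)}
    {S : Finset (Fin m)} {i : Fin m} (hi : i ∉ S) {z : (Fin d → ℝ) × (Fin m → ℝ)}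
    (hz : z ∈ subCayleyPolytope d m V S) : z.2 i = 0 := by
  let g : ((Fin d → ℝ) × (Fin m → ℝ)) →ₗ[ℝ] ℝ :=
    LinearMap.proj i ∘ₗ LinearMap.snd ℝ (Fin d → ℝ) (Fin m → ℝ)
  refine convexHull_min (t := (LinearMap.ker g : Set _)) ?_ (LinearMap.ker g).convex hz
  rintro ⟨x, μ⟩ h
  simp only [Set.mem_iUnion] at h
  obtain ⟨j, hj, hx, rfl⟩ := h
  have hij : i ≠ j := fun h => hi (h ▸ hj)
  simp [g, hij]

theorem mem_subCayleyPolytope_of_snd_eq_zero {d m : ℕ} {V : Fin m → Set (Fin d → ℝ)}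
    {i : Fin m} {z : (Fin d → ℝ) × (Fin m → ℝ)}
    (hz : z ∈ cayleySet fun i => convexHull ℝ (V i)) (hi : z.2 i = 0) :
    z ∈ subCayleyPolytope d m V (Finset.univ.erase i) := by
  obtain ⟨hμ, p, hp, hzp⟩ := hz
  rw [eq_sum_smul_mk_single hzp, ← Finset.sum_erase Finset.univ (a := i) (by simp [hi])]
  refine (convex_convexHull ℝ _).sum_mem (fun j _ => hμ.1 j) ?_ fun j hj =>
    subset_convexHull ℝ _ (Set.mem_iUnion₂.2 ⟨j, hj, hp j, rfl⟩)
  rw [Finset.sum_erase _ hi, hμ.2]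

theorem eq_of_prod_singleton_eq {α β : Type*} {s t : Set α} {b : β}
    (h : s ×ˢ ({b} : Set β) = t ×ˢ {b}) : s = t := by
  ext x
  simpa using Set.ext_iff.1 h (x, b)

/-- The Cayley trick, face correspondence form: slicing at an interior simplex point `λ`
gives a bijection between the nonempty exposed faces of the Cayley polytope not contained
in any proper sub-Cayley polytope and the (slices at `λ` of the) nonempty exposed faces of
the weighted Minkowski sum `λ 1 • P 1 + ⋯ + λ m • P m`; moreover corresponding faces satisfy
`dim G = dim F + m - 1`. -/
theorem cayley_trick_face_bijection (d m : ℕ) (hm : 1 ≤ m)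
    (V : Fin m → Set (Fin d → ℝ)) (hV : ∀ i, (V i).Finite) (hVne : ∀ i, (V i).Nonempty)
    (lam : Fin m → ℝ) (hpos : ∀ i, 0 < lam i) (hsum : ∑ i : Fin m, lam i = 1) :
    Set.BijOn (fun G : Set ((Fin d → ℝ) × (Fin m → ℝ)) =>
        G ∩ (Set.univ ×ˢ ({lam} : Set (Fin m → ℝ))))
      {G | IsExposed ℝ (cayleyPolytope d m V) G ∧ G.Nonempty ∧
        ∀ S : Finset (Fin m), S ≠ Finset.univ → ¬ G ⊆ subCayleyPolytope d m V S}
      {T | ∃ F : Set (Fin d → ℝ),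
        IsExposed ℝ (∑ i : Fin m, lam i • convexHull ℝ (V i)) F ∧ F.Nonempty ∧
          T = F ×ˢ ({lam} : Set (Fin m → ℝ))} ∧
    ∀ G : Set ((Fin d → ℝ) × (Fin m → ℝ)),
      IsExposed ℝ (cayleyPolytope d m V) G → G.Nonempty →
      (∀ S : Finset (Fin m), S ≠ Finset.univ → ¬ G ⊆ subCayleyPolytope d m V S) →
      ∀ F : Set (Fin d → ℝ),
        IsExposed ℝ (∑ i : Fin m, lam i • convexHull ℝ (V i)) F → F.Nonempty →
        G ∩ (Set.univ ×ˢ ({lam} : Set (Fin m → ℝ))) = F ×ˢ ({lam} : Set (Fin m → ℝ)) →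
        Module.finrank ℝ (affineSpan ℝ G).direction =
          Module.finrank ℝ (affineSpan ℝ F).direction + m - 1 := by
  have : Nonempty (Fin m) := ⟨⟨0, hm⟩⟩
  have hlam : lam ∈ stdSimplex ℝ (Fin m) := ⟨fun i => (hpos i).le, hsum⟩
  have hne : ∀ i, (convexHull ℝ (V i)).Nonempty := fun i => (hVne i).convexHull
  have hcay : cayleyPolytope d m V = cayleySet fun i => convexHull ℝ (V i) :=
    convexHull_iUnion_prod_single (fun i => convex_convexHull ℝ (V i)) hne
  have hface_ne : ∀ (f : StrongDual ℝ (Fin d → ℝ)) i,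
      (f.toExposed (convexHull ℝ (V i))).Nonempty := by
    intro f i
    obtain ⟨x, hx, hmax⟩ := ((hV i).isCompact_convexHull ℝ).exists_isMaxOn (hne i)
      f.continuous.continuousOn
    exact ⟨x, hx, fun y hy => hmax hy⟩
  have hrep : ∀ G : Set ((Fin d → ℝ) × (Fin m → ℝ)), IsExposed ℝ (cayleyPolytope d m V) G →
      G.Nonempty → (∀ S : Finset (Fin m), S ≠ Finset.univ → ¬ G ⊆ subCayleyPolytope d m V S) →
      ∃ f : StrongDual ℝ (Fin d → ℝ), G = cayleySet fun i => f.toExposed (convexHull ℝ (V i)) := by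
    intro G hG hGne hGS
    rw [hcay] at hG
    obtain ⟨f, -, hf⟩ := hG.exists_eq_cayleySet hne hGne fun i => by
      by_contra! h
      exact hGS (Finset.univ.erase i) (Finset.erase_ssubset (Finset.mem_univ i)).ne
        fun z hz => mem_subCayleyPolytope_of_snd_eq_zero (hG.subset hz) (h z hz)
    exact ⟨f, hf⟩
  refine ⟨⟨?_, ?_, ?_⟩, ?_⟩
  · rintro G ⟨hG, hGne, hGS⟩
    obtain ⟨f, rfl⟩ := hrep G hG hGne hGS
    choose q hq using hface_ne f
    refine ⟨∑ i, lam i • f.toExposed (convexHull ℝ (V i)), ?_, ?_,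
      cayleySet_inter_prod_singleton hlam _⟩
    · rw [← toExposed_sum_smul hpos]
      exact ContinuousLinearMap.toExposed.isExposed
    · exact ⟨_, mem_sum_smul_iff.2 ⟨q, hq, rfl⟩⟩
  · rintro G ⟨hG, hGne, hGS⟩ H ⟨hH, hHne, hHS⟩ hGH
    obtain ⟨f, rfl⟩ := hrep G hG hGne hGS
    obtain ⟨g, rfl⟩ := hrep H hH hHne hHS
    simp only [cayleySet_inter_prod_singleton hlam] at hGH
    have h := eq_of_prod_singleton_eq hGH
    congr 1
    funext i
    exact (toExposed_le_of_sum_smul_eq hpos (hface_ne f) h i).antisymm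
      (toExposed_le_of_sum_smul_eq hpos (hface_ne g) h.symm i)
  · rintro T ⟨F, hF, hFne, rfl⟩
    obtain ⟨f, hf⟩ := hF hFne
    choose q hq using hface_ne f
    refine ⟨cayleySet fun i => f.toExposed (convexHull ℝ (V i)), ⟨?_, ?_, fun S hS hsub => ?_⟩, ?_⟩
    · rw [hcay]
      exact isExposed_cayleySet_toExposed f (hface_ne f)
    · exact ⟨_, mk_single_mem_cayleySet hq (hq (Classical.arbitrary _))⟩
    · obtain ⟨i, hi⟩ : ∃ i, i ∉ S := by
        by_contra! h
        exact hS (Finset.eq_univ_iff_forall.2 h)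
      have := snd_eq_zero_of_mem_subCayleyPolytope hi
        (hsub (mk_single_mem_cayleySet hq (hq i)))
      simp at this
    · dsimp only
      rw [cayleySet_inter_prod_singleton hlam, ← toExposed_sum_smul hpos, hf]
      rfl
  · intro G hG hGne hGS F _ _ hGF
    obtain ⟨f, rfl⟩ := hrep G hG hGne hGS
    rw [cayleySet_inter_prod_singleton hlam] at hGF
    have h := eq_of_prod_singleton_eq hGF
    rw [direction_affineSpan, direction_affineSpan, ← h,
      finrank_vectorSpan_cayleySet hlam hpos (hface_ne f), Fintype.card_fin]
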